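/- Let A ∈ ℂ^{n×n}; let z_1, ..., z_N ∈ ℂ be points listed with repetitions; let f be analytic on an open convex set U containing σ(A) and z_1, ..., z_N. Let v be a polynomial with v(z_k) ≠ 0 for all k and v(λ) ≠ 0 for all λ ∈ σ(A), and let u be a polynomial with deg u ≤ N − 1 such that r = u/v interpolates f at z_1, ..., z_N (counted according to multiplicities). Then f(A) − u(A)·(v(A))^{−1} = Ω(A)·(v(A))^{−1} · ∫_0^1 ∫_0^{t_1} ⋯ ∫_0^{t_{N−1}} g((1−t_1)z_1·I + (t_1−t_2)z_2·I + ⋯ + (t_{N−1}−t_N)z_N·I + t_N·A) dt_N ⋯ dt_1, where g = (v·f)^{(N)} is the N-th derivative of v·f and g is applied to matrices via the holomorphic functional calculus. -/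

import Mathlib

open Polynomial MeasureTheory

/-- `MatFunEq A h B` expresses that `B = h(A)` where `h` (analytic on a neighborhood of
the spectrum of `A`) is applied to the matrix `A` via the holomorphic functional calculus:
equivalently, `B = p(A)` for every polynomial `p` that interpolates `h` at the eigenvalues
of `A` with their algebraic multiplicities. -/
def MatFunEq {n : ℕ} (A : Matrix (Fin n) (Fin n) ℂ) (h : ℂ → ℂ)
    (B : Matrix (Fin n) (Fin n) ℂ) : Prop :=
  ∀ p : Polynomial ℂ,
    (∀ μ ∈ spectrum ℂ A, ∀ j < (Matrix.charpoly A).rootMultiplicity μ,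
        iteratedDeriv j h μ = iteratedDeriv j (fun w => p.eval w) μ) →
    B = Polynomial.aeval A p

/-- The ordered simplex `1 ≥ t 0 ≥ t 1 ≥ ⋯ ≥ t (N-1) ≥ 0`, the domain of the iterated
integral `∫_0^1 ∫_0^{t_1} ⋯ ∫_0^{t_{N−1}} ⋯ dt_N ⋯ dt_1`. -/
def orderedSimplex (N : ℕ) : Set (Fin N → ℝ) :=
  {t | Antitone t ∧ ∀ i, t i ∈ Set.Icc (0 : ℝ) 1}

/-- `t₀ = 1` prepended to the integration variables `t₁, …, t_N`. -/
def consOne {N : ℕ} (t : Fin N → ℝ) : Fin (N + 1) → ℝ := Fin.cons 1 t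

theorem analyticOnNhd_iteratedDeriv {U : Set ℂ} {g : ℂ → ℂ} (hg : AnalyticOnNhd ℂ g U) (j : ℕ) :
    AnalyticOnNhd ℂ (iteratedDeriv j g) U := by
  rw [iteratedDeriv_eq_iterate]
  exact hg.iterated_deriv j

theorem rootMultiplicity_charpoly_le {n : ℕ} (A : Matrix (Fin n) (Fin n) ℂ) (a : ℂ) :
    A.charpoly.rootMultiplicity a ≤ n :=
  calc _ ≤ A.charpoly.roots.card := by
        rw [← count_roots]; exact Multiset.count_le_card _ _
    _ ≤ A.charpoly.natDegree := card_roots' _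
    _ = n := by simp

theorem iteratedDeriv_polynomial_eval (P : ℂ[X]) (j : ℕ) (x : ℂ) :
    iteratedDeriv j (fun w => P.eval w) x = (derivative^[j] P).eval x := by
  induction j generalizing P with
  | zero => simp
  | succ j ih =>
    rw [iteratedDeriv_succ', Function.iterate_succ_apply, ← ih]
    congr 1
    ext w
    exact P.deriv

theorem analyticAt_polynomial_eval (P : ℂ[X]) (x : ℂ) : AnalyticAt ℂ (fun w => P.eval w) x := by
  simpa using AnalyticAt.aeval_polynomial (analyticAt_id (𝕜 := ℂ) (z := x)) P

theorem natCast_le_analyticOrderAt_sub_iff {f g : ℂ → ℂ} {x : ℂ} (hf : AnalyticAt ℂ f x)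
    (hg : AnalyticAt ℂ g x) {m : ℕ} :
    (m : ℕ∞) ≤ analyticOrderAt (f - g) x ↔
      ∀ j < m, iteratedDeriv j f x = iteratedDeriv j g x := by
  rw [natCast_le_analyticOrderAt_iff_iteratedDeriv_eq_zero (hf.sub hg)]
  refine forall₂_congr fun j _ => ?_
  rw [iteratedDeriv_sub hf.contDiffAt hg.contDiffAt, sub_eq_zero]

theorem X_sub_C_pow_dvd_of_le_analyticOrderAt {P : ℂ[X]} {a : ℂ} {m : ℕ}
    (h : (m : ℕ∞) ≤ analyticOrderAt (fun w => P.eval w) a) : (X - C a) ^ m ∣ P := by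
  rcases eq_or_ne P 0 with rfl | hP
  · exact dvd_zero _
  rw [natCast_le_analyticOrderAt_iff_iteratedDeriv_eq_zero (analyticAt_polynomial_eval P a)] at h
  rw [← le_rootMultiplicity_iff hP]
  rcases m with _ | m
  · simp
  · rw [Nat.succ_le_iff, lt_rootMultiplicity_iff_isRoot_iterate_derivative hP]
    intro j hj
    rw [IsRoot, ← iteratedDeriv_polynomial_eval]
    exact h j (by omega)

theorem prod_X_sub_C_pow_dvd_of_le_analyticOrderAt {P : ℂ[X]} (S : Finset ℂ) (m : ℂ → ℕ)
    (h : ∀ a ∈ S, (m a : ℕ∞) ≤ analyticOrderAt (fun w => P.eval w) a) :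
    ∏ a ∈ S, (X - C a) ^ m a ∣ P :=
  Finset.prod_dvd_of_coprime
    (fun _ _ _ _ hab => (pairwise_coprime_X_sub_C Function.injective_id hab).pow)
    fun a ha => X_sub_C_pow_dvd_of_le_analyticOrderAt (h a ha)

theorem aeval_eq_zero_of_le_analyticOrderAt {n : ℕ} (A : Matrix (Fin n) (Fin n) ℂ) {P : ℂ[X]}
    (h : ∀ a ∈ spectrum ℂ A, (n : ℕ∞) ≤ analyticOrderAt (fun w => P.eval w) a) :
    aeval A P = 0 := by
  have hdvd : A.charpoly ∣ P := by
    have hsplit := (IsAlgClosed.splits A.charpoly).eq_prod_roots_of_monic A.charpoly_monic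
    rw [hsplit, prod_multiset_root_eq_finset_root]
    refine dvd_trans (Finset.prod_dvd_prod_of_dvd _ (fun a => (X - C a) ^ n) fun a _ =>
      pow_dvd_pow _ (rootMultiplicity_charpoly_le A a))
      (prod_X_sub_C_pow_dvd_of_le_analyticOrderAt _ (fun _ => n) fun a ha => h a ?_)
    exact Matrix.mem_spectrum_iff_isRoot_charpoly.2
      (mem_roots'.1 (Multiset.mem_toFinset.1 ha)).2
  obtain ⟨Q, rfl⟩ := hdvd
  simp [Matrix.aeval_self_charpoly]

theorem exists_linear_hermite_interpolation (S : Finset ℂ) (m : ℕ) :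
    ∃ T : (S → Fin m → ℂ) →ₗ[ℂ] ℂ[X], ∀ a (s : S) (j : Fin m),
      iteratedDeriv j (fun w => (T a).eval w) s = a s j := by
  let J : degreeLT ℂ (S.card * m) →ₗ[ℂ] (S → Fin m → ℂ) :=
    LinearMap.pi fun s => LinearMap.pi fun j =>
      (leval (s : ℂ)) ∘ₗ (derivative ^ (j : ℕ)) ∘ₗ (degreeLT ℂ (S.card * m)).subtype
  have hJ (P s j) : J P s j = iteratedDeriv j (fun w => (P : ℂ[X]).eval w) s := by
    rw [iteratedDeriv_polynomial_eval]
    simp [J, leval, Module.End.pow_apply]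
  have hinj : Function.Injective J := by
    rw [injective_iff_map_eq_zero]
    intro P hP
    have hdvd : ∏ a ∈ S, (X - C a) ^ m ∣ (P : ℂ[X]) := by
      refine prod_X_sub_C_pow_dvd_of_le_analyticOrderAt S (fun _ => m) fun a ha => ?_
      rw [natCast_le_analyticOrderAt_iff_iteratedDeriv_eq_zero (analyticAt_polynomial_eval _ a)]
      intro j hj
      rw [← hJ P ⟨a, ha⟩ ⟨j, hj⟩, hP]
      rfl
    refine Subtype.ext (eq_zero_of_dvd_of_degree_lt hdvd ?_)
    refine (mem_degreeLT.1 P.2).trans_le (le_of_eq ?_)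
    simp [degree_prod, degree_pow]
  have hdim : Module.finrank ℂ (degreeLT ℂ (S.card * m)) =
      Module.finrank ℂ (S → Fin m → ℂ) := by
    rw [(degreeLTEquiv ℂ _).finrank_eq, Module.finrank_fin_fun, Module.finrank_pi_fintype]
    simp
  have : Module.Finite ℂ (degreeLT ℂ (S.card * m)) :=
    Module.Finite.equiv (degreeLTEquiv ℂ _).symm
  obtain ⟨R, hR⟩ := J.exists_rightInverse_of_surjective
    (LinearMap.range_eq_top.2 ((LinearMap.injective_iff_surjective_of_finrank_eq_finrank hdim).1
      hinj))
  refine ⟨(degreeLT ℂ (S.card * m)).subtype ∘ₗ R, fun a s j => ?_⟩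
  have := hJ (R a) s j
  rw [← LinearMap.comp_apply, hR] at this
  exact this.symm

/-- The point `(1 - t₁) z₁ + ⋯ + (t_{N-1} - t_N) z_N + t_N x`. -/
noncomputable def simplexPoint {N : ℕ} (z : Fin N → ℂ) (t : Fin N → ℝ) (x : ℂ) : ℂ :=
  ∑ k : Fin N, (((consOne t k.castSucc - consOne t k.succ : ℝ) : ℂ) * z k)
    + ((consOne t (Fin.last N) : ℝ) : ℂ) * x

theorem consOne_snoc {N : ℕ} (t : Fin N → ℝ) (s : ℝ) :
    consOne (Fin.snoc t s : Fin (N + 1) → ℝ) = Fin.snoc (consOne t) s :=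
  Fin.cons_snoc_eq_snoc_cons _ _ _

theorem continuous_consOne {N : ℕ} (k : Fin (N + 1)) :
    Continuous fun t : Fin N → ℝ => consOne t k := by
  refine Fin.cases ?_ (fun i => ?_) k
  · simpa [consOne] using continuous_const
  · simpa [consOne] using continuous_apply i

theorem continuous_simplexPoint {N : ℕ} (z : Fin N → ℂ) :
    Continuous fun p : (Fin N → ℝ) × ℂ => simplexPoint z p.1 p.2 := by
  have h (k : Fin (N + 1)) : Continuous fun p : (Fin N → ℝ) × ℂ => consOne p.1 k :=
    (continuous_consOne k).comp continuous_fst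
  unfold simplexPoint
  fun_prop

theorem hasDerivAt_simplexPoint {N : ℕ} (z : Fin N → ℂ) (t : Fin N → ℝ) (x : ℂ) :
    HasDerivAt (simplexPoint z t) (consOne t (Fin.last N) : ℂ) x := by
  unfold simplexPoint
  simpa only [id, mul_one] using ((hasDerivAt_id x).const_mul
    ((consOne t (Fin.last N) : ℝ) : ℂ)).const_add
      (∑ k : Fin N, (((consOne t k.castSucc - consOne t k.succ : ℝ) : ℂ) * z k))

theorem simplexPoint_snoc {N : ℕ} (z : Fin (N + 1) → ℂ) (t : Fin N → ℝ) (s : ℝ) (x : ℂ) :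
    simplexPoint z (Fin.snoc t s) x =
      simplexPoint (Fin.init z) t (z (Fin.last N)) + s * (x - z (Fin.last N)) := by
  simp only [simplexPoint, consOne_snoc, Fin.sum_univ_castSucc, Fin.snoc_castSucc, Fin.succ_last,
    Fin.snoc_last, ← Fin.castSucc_succ, Fin.init]
  push_cast
  ring

theorem simplexPoint_eq_add_mul_sub {N : ℕ} (z : Fin N → ℂ) (t : Fin N → ℝ) (x y : ℂ) :
    simplexPoint z t x = simplexPoint z t y + (consOne t (Fin.last N) : ℂ) * (x - y) := by
  simp only [simplexPoint]
  ring

theorem antitone_consOne {N : ℕ} {t : Fin N → ℝ} (ht : t ∈ orderedSimplex N) :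
    Antitone (consOne t) := by
  intro i j hij
  induction i using Fin.cases with
  | zero =>
    induction j using Fin.cases with
    | zero => rfl
    | succ j => simpa [consOne] using (ht.2 j).2
  | succ i =>
    induction j using Fin.cases with
    | zero => simp at hij
    | succ j => simpa [consOne] using ht.1 (Fin.succ_le_succ_iff.1 hij)

theorem consOne_mem_Icc {N : ℕ} {t : Fin N → ℝ} (ht : t ∈ orderedSimplex N) (k : Fin (N + 1)) :
    consOne t k ∈ Set.Icc (0 : ℝ) 1 := by
  refine Fin.cases ?_ (fun i => ?_) k
  · simp [consOne]
  · simpa [consOne] using ht.2 i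

theorem snoc_mem_orderedSimplex_iff {N : ℕ} {t : Fin N → ℝ} {s : ℝ} :
    (Fin.snoc t s : Fin (N + 1) → ℝ) ∈ orderedSimplex (N + 1) ↔
      t ∈ orderedSimplex N ∧ s ∈ Set.Icc 0 (consOne t (Fin.last N)) := by
  constructor
  · intro h
    have ht : t ∈ orderedSimplex N := by
      refine ⟨fun i j hij => ?_, fun i => ?_⟩
      · simpa using h.1 (Fin.castSucc_le_castSucc_iff.2 hij)
      · simpa using h.2 i.castSucc
    refine ⟨ht, ?_, ?_⟩
    · simpa using (h.2 (Fin.last N)).1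
    · have := antitone_consOne h (Fin.le_last (Fin.last N).castSucc)
      simpa [consOne_snoc] using this
  · rintro ⟨ht, hs⟩
    have hle (i : Fin N) : s ≤ t i := by
      refine hs.2.trans ?_
      simpa [consOne] using antitone_consOne ht (Fin.le_last i.succ)
    refine ⟨fun i j hij => ?_, fun i => ?_⟩
    · induction j using Fin.lastCases with
      | last =>
        induction i using Fin.lastCases with
        | last => rfl
        | cast i => simpa using hle i
      | cast j =>
        induction i using Fin.lastCases with
        | last => exact absurd hij (not_le.2 (Fin.castSucc_lt_last j))
        | cast i => simpa using ht.1 (Fin.castSucc_le_castSucc_iff.1 hij)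
    · induction i using Fin.lastCases with
      | last => simpa using ⟨hs.1, hs.2.trans (consOne_mem_Icc ht _).2⟩
      | cast i => simpa using ht.2 i

theorem isCompact_orderedSimplex (N : ℕ) : IsCompact (orderedSimplex N) := by
  have h : orderedSimplex N =
      {t | Antitone t} ∩ Set.univ.pi fun _ => Set.Icc (0 : ℝ) 1 := by
    ext t
    simp only [orderedSimplex, Set.mem_inter_iff, Set.mem_univ_pi]
    rfl
  rw [h]
  refine (isCompact_univ_pi fun _ => isCompact_Icc).inter_left ?_
  simp only [Antitone, Set.ofPred_forall]
  exact isClosed_iInter fun i => isClosed_iInter fun j => isClosed_iInter fun _ =>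
    isClosed_le (continuous_apply j) (continuous_apply i)

theorem simplexPoint_mem {N : ℕ} {z : Fin N → ℂ} {U : Set ℂ} (hU : Convex ℝ U)
    (hz : ∀ k, z k ∈ U) {t : Fin N → ℝ} (ht : t ∈ orderedSimplex N) {x : ℂ} (hx : x ∈ U) :
    simplexPoint z t x ∈ U := by
  induction N generalizing x with
  | zero => simpa [simplexPoint, consOne] using hx
  | succ N ih =>
    obtain ⟨t, s, rfl⟩ : ∃ (t' : Fin N → ℝ) (s : ℝ), t = Fin.snoc t' s :=
      ⟨Fin.init t, t (Fin.last N), (Fin.snoc_init_self t).symm⟩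
    obtain ⟨ht, hs⟩ := snoc_mem_orderedSimplex_iff.1 ht
    have hy := ih (z := Fin.init z) (fun k => hz _) ht (hz (Fin.last N))
    have hx' := ih (z := Fin.init z) (fun k => hz _) ht hx
    rw [simplexPoint_snoc]
    rw [simplexPoint_eq_add_mul_sub _ _ x (z (Fin.last N))] at hx'
    rcases hs.1.eq_or_lt with rfl | hs0
    · simpa using hy
    have hτ : 0 < consOne t (Fin.last N) := hs0.trans_le hs.2
    have := hU.add_smul_mem hy hx' (t := s / consOne t (Fin.last N))
      ⟨by positivity, (div_le_one hτ).2 hs.2⟩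
    convert this using 2
    rw [Complex.real_smul]
    push_cast
    have : (consOne t (Fin.last N) : ℂ) ≠ 0 := by exact_mod_cast hτ.ne'
    field_simp

theorem setIntegral_orderedSimplex_succ {N : ℕ} {F : (Fin (N + 1) → ℝ) → ℂ}
    (hF : ContinuousOn F (orderedSimplex (N + 1))) :
    ∫ t in orderedSimplex (N + 1), F t =
      ∫ t in orderedSimplex N, ∫ s in (0 : ℝ)..consOne t (Fin.last N), F (Fin.snoc t s) := by
  let e := (MeasurableEquiv.piFinSuccAbove (fun _ : Fin (N + 1) => ℝ) (Fin.last N)).symm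
  have he : MeasurePreserving e :=
    (volume_preserving_piFinSuccAbove (fun _ : Fin (N + 1) => ℝ) (Fin.last N)).symm _
  have heq (s : ℝ) (t : Fin N → ℝ) : e (s, t) = Fin.snoc t s := by
    simp [e, MeasurableEquiv.piFinSuccAbove]
    rfl
  have hm (k : ℕ) : MeasurableSet (orderedSimplex k) := (isCompact_orderedSimplex k).measurableSet
  have hint : IntegrableOn (F ∘ e) (e ⁻¹' orderedSimplex (N + 1)) :=
    (he.integrableOn_comp_preimage e.measurableEmbedding).2
      (hF.integrableOn_compact (isCompact_orderedSimplex _))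
  have hme := e.measurable (hm (N + 1))
  rw [← he.setIntegral_preimage_emb e.measurableEmbedding, ← integral_indicator hme]
  replace hint := (integrable_indicator_iff hme).2 hint
  rw [Measure.volume_eq_prod] at hint ⊢
  rw [← integral_indicator (hm N)]
  refine (integral_prod_symm _ hint).trans (integral_congr_ae (.of_forall fun t => ?_))
  by_cases ht : t ∈ orderedSimplex N
  · simp only [Set.indicator_of_mem ht]
    rw [intervalIntegral.integral_of_le (consOne_mem_Icc ht _).1, ← integral_Icc_eq_integral_Ioc,
      ← integral_indicator measurableSet_Icc]
    refine integral_congr_ae (.of_forall fun s => ?_)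
    simp only [Set.indicator, Set.mem_preimage, heq, snoc_mem_orderedSimplex_iff, ht, true_and,
      Function.comp_apply]
  · simp [Set.indicator, heq, snoc_mem_orderedSimplex_iff, ht]

theorem hasDerivAt_setIntegral_simplexPoint {N : ℕ} {z : Fin N → ℂ} {U : Set ℂ} (hUo : IsOpen U)
    (hU : Convex ℝ U) (hz : ∀ k, z k ∈ U) {g : ℂ → ℂ} (hg : AnalyticOnNhd ℂ g U) (j : ℕ) {x : ℂ}
    (hx : x ∈ U) :
    HasDerivAt
      (fun x => ∫ t in orderedSimplex N,
        (consOne t (Fin.last N) : ℂ) ^ j * g (simplexPoint z t x))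
      (∫ t in orderedSimplex N,
        (consOne t (Fin.last N) : ℂ) ^ (j + 1) * deriv g (simplexPoint z t x)) x := by
  have hS := isCompact_orderedSimplex N
  have hτ : Continuous fun t : Fin N → ℝ => (consOne t (Fin.last N) : ℂ) :=
    Complex.continuous_ofReal.comp (continuous_consOne _)
  have hcont {φ : ℂ → ℂ} (hφ : ContinuousOn φ U) (i : ℕ) : ContinuousOn
      (fun p : (Fin N → ℝ) × ℂ => (consOne p.1 (Fin.last N) : ℂ) ^ i * φ (simplexPoint z p.1 p.2))
      (orderedSimplex N ×ˢ U) :=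
    ((hτ.comp continuous_fst).pow i).continuousOn.mul
      (hφ.comp (continuous_simplexPoint z).continuousOn
        fun p hp => simplexPoint_mem hU hz hp.1 hp.2)
  have hcont' {φ : ℂ → ℂ} (hφ : ContinuousOn φ U) (i : ℕ) {y : ℂ} (hy : y ∈ U) : ContinuousOn
      (fun t : Fin N → ℝ => (consOne t (Fin.last N) : ℂ) ^ i * φ (simplexPoint z t y))
      (orderedSimplex N) :=
    (hcont hφ i).comp (f := fun t => (t, y)) (by fun_prop) fun t ht => ⟨ht, hy⟩
  obtain ⟨ε, hε, hball⟩ := Metric.nhds_basis_closedBall.mem_iff.1 (hUo.mem_nhds hx)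
  obtain ⟨C, hC⟩ := (hS.prod (isCompact_closedBall x ε)).exists_bound_of_continuousOn
    ((hcont hg.deriv.continuousOn (j + 1)).mono (Set.prod_mono_right hball))
  refine (hasDerivAt_integral_of_dominated_loc_of_deriv_le (bound := fun _ => C)
    (F := fun x t => (consOne t (Fin.last N) : ℂ) ^ j * g (simplexPoint z t x))
    (F' := fun x t => (consOne t (Fin.last N) : ℂ) ^ (j + 1) * deriv g (simplexPoint z t x))
    (Metric.closedBall_mem_nhds x hε) ?_ ?_ ?_ ?_ ?_ ?_).2
  · filter_upwards [hUo.mem_nhds hx] with y hy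
    exact (hcont' hg.continuousOn j hy).aestronglyMeasurable hS.measurableSet
  · exact (hcont' hg.continuousOn j hx).integrableOn_compact hS
  · exact (hcont' hg.deriv.continuousOn (j + 1) hx).aestronglyMeasurable hS.measurableSet
  · exact (ae_restrict_mem hS.measurableSet).mono fun t ht y hy => hC (t, y) ⟨ht, hy⟩
  · have : IsFiniteMeasure (volume.restrict (orderedSimplex N)) :=
      ⟨by simpa using hS.measure_lt_top⟩
    exact integrable_const (C : ℝ)
  · refine (ae_restrict_mem hS.measurableSet).mono fun t ht y hy => ?_
    have := ((hg _ (simplexPoint_mem hU hz ht (hball hy))).differentiableAt.hasDerivAt.comp y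
      (hasDerivAt_simplexPoint z t y)).const_mul ((consOne t (Fin.last N) : ℂ) ^ j)
    exact this.congr_deriv (by ring)

theorem iteratedDeriv_eq_of_forall_hasDerivAt {U : Set ℂ} (hU : IsOpen U) {F : ℕ → ℂ → ℂ}
    (hF : ∀ j, ∀ x ∈ U, HasDerivAt (F j) (F (j + 1) x) x) (j : ℕ) {x : ℂ} (hx : x ∈ U) :
    iteratedDeriv j (F 0) x = F j x := by
  induction j generalizing x with
  | zero => simp
  | succ j ih =>
    have h : iteratedDeriv j (F 0) =ᶠ[nhds x] F j :=
      Filter.eventually_of_mem (hU.mem_nhds hx) fun y hy => ih hy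
    rw [iteratedDeriv_succ, h.deriv_eq, (hF j x hx).deriv]

theorem iteratedDeriv_comp_simplexPoint {N : ℕ} {z : Fin N → ℂ} {U : Set ℂ} (hUo : IsOpen U)
    (hU : Convex ℝ U) (hz : ∀ k, z k ∈ U) {g : ℂ → ℂ} (hg : AnalyticOnNhd ℂ g U) (j : ℕ) {x : ℂ}
    (hx : x ∈ U) {t : Fin N → ℝ} (ht : t ∈ orderedSimplex N) :
    iteratedDeriv j (fun x => g (simplexPoint z t x)) x =
      (consOne t (Fin.last N) : ℂ) ^ j * iteratedDeriv j g (simplexPoint z t x) := by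
  have := iteratedDeriv_eq_of_forall_hasDerivAt hUo (F := fun j x =>
    (consOne t (Fin.last N) : ℂ) ^ j * iteratedDeriv j g (simplexPoint z t x)) (fun j y hy => ?_)
    j hx
  · simpa using this
  · have hgj := analyticOnNhd_iteratedDeriv hg j
    have := ((hgj _ (simplexPoint_mem hU hz ht hy)).differentiableAt.hasDerivAt.comp y
      (hasDerivAt_simplexPoint z t y)).const_mul ((consOne t (Fin.last N) : ℂ) ^ j)
    exact this.congr_deriv (by rw [iteratedDeriv_succ]; ring)

theorem iteratedDeriv_setIntegral_simplexPoint {N : ℕ} {z : Fin N → ℂ} {U : Set ℂ}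
    (hUo : IsOpen U) (hU : Convex ℝ U) (hz : ∀ k, z k ∈ U) {g : ℂ → ℂ} (hg : AnalyticOnNhd ℂ g U)
    (j : ℕ) {x : ℂ} (hx : x ∈ U) :
    iteratedDeriv j (fun x => ∫ t in orderedSimplex N, g (simplexPoint z t x)) x =
      ∫ t in orderedSimplex N,
        (consOne t (Fin.last N) : ℂ) ^ j * iteratedDeriv j g (simplexPoint z t x) := by
  have := iteratedDeriv_eq_of_forall_hasDerivAt hUo (F := fun j x =>
    ∫ t in orderedSimplex N,
      (consOne t (Fin.last N) : ℂ) ^ j * iteratedDeriv j g (simplexPoint z t x))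
    (fun j y hy => ?_) j hx
  · simpa using this
  · have hgj := analyticOnNhd_iteratedDeriv hg j
    simpa [iteratedDeriv_succ] using hasDerivAt_setIntegral_simplexPoint hUo hU hz hgj j hy

theorem exists_newton_remainder {N : ℕ} {z : Fin N → ℂ} {U : Set ℂ}
    (hU : Convex ℝ U) (hz : ∀ k, z k ∈ U) {h : ℂ → ℂ} (hh : AnalyticOnNhd ℂ h U) :
    ∃ q : ℂ[X], q.degree < N ∧ ∀ x ∈ U, h x = q.eval x + (∏ k, (X - C (z k))).eval x *
      ∫ t in orderedSimplex N, iteratedDeriv N h (simplexPoint z t x) := by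
  induction N with
  | zero =>
    refine ⟨0, by simp, fun x _ => ?_⟩
    have hS : orderedSimplex 0 = Set.univ :=
      Set.eq_univ_of_forall fun t => ⟨fun i => i.elim0, fun i => i.elim0⟩
    rw [hS, Measure.restrict_univ, volume_pi, Measure.pi_of_empty (x := Fin.elim0)]
    simp [simplexPoint, consOne]
  | succ N ih =>
    obtain ⟨q, hq, hqx⟩ := ih (z := Fin.init z) fun k => hz _
    set a := z (Fin.last N)
    set D : ℂ → ℂ := fun x =>
      ∫ t in orderedSimplex N, iteratedDeriv N h (simplexPoint (Fin.init z) t x)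
    have hhj (j : ℕ) := analyticOnNhd_iteratedDeriv hh j
    have hcont {M : ℕ} {w : Fin M → ℂ} (hw : ∀ k, w k ∈ U) (j : ℕ) {x : ℂ} (hx : x ∈ U) :
        ContinuousOn (fun t => iteratedDeriv j h (simplexPoint w t x)) (orderedSimplex M) :=
      (hhj j).continuousOn.comp
        ((continuous_simplexPoint w).comp (by fun_prop : Continuous fun t => (t, x))).continuousOn
        fun t ht => simplexPoint_mem hU hw ht hx
    refine ⟨q + C (D a) * ∏ k, (X - C (Fin.init z k)), ?_, fun x hx => ?_⟩
    · refine (degree_add_le _ _).trans_lt (max_lt (hq.trans ?_) ?_)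
      · exact_mod_cast N.lt_succ_self
      · rw [← smul_eq_C_mul]
        refine (degree_smul_le _ _).trans_lt ?_
        simp only [degree_prod, degree_X_sub_C, Finset.sum_const, Finset.card_univ,
          Fintype.card_fin, nsmul_eq_mul, mul_one]
        exact_mod_cast N.lt_succ_self
    · have key : (x - a) * ∫ t in orderedSimplex (N + 1),
          iteratedDeriv (N + 1) h (simplexPoint z t x) = D x - D a := by
        rw [setIntegral_orderedSimplex_succ (hcont hz (N + 1) hx), ← integral_const_mul]
        simp only [D]
        rw [← integral_sub]
        rotate_left
        · exact (hcont (fun k => hz _) N hx).integrableOn_compact (isCompact_orderedSimplex N)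
        · exact (hcont (fun k => hz _) N (hz _)).integrableOn_compact (isCompact_orderedSimplex N)
        refine setIntegral_congr_fun (isCompact_orderedSimplex N).measurableSet fun t ht => ?_
        have hτ := (consOne_mem_Icc ht (Fin.last N)).1
        have hmem {s : ℝ} (hs : s ∈ Set.uIcc 0 (consOne t (Fin.last N))) :
            simplexPoint z (Fin.snoc t s) x ∈ U := by
          rw [Set.uIcc_of_le hτ] at hs
          exact simplexPoint_mem hU hz (snoc_mem_orderedSimplex_iff.2 ⟨ht, hs⟩) hx
        have hpath (s : ℝ) : HasDerivAt (fun s : ℝ => simplexPoint z (Fin.snoc t s) x)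
            (x - a) s := by
          simp only [simplexPoint_snoc]
          simpa using (((hasDerivAt_id s).ofReal_comp.mul_const (x - a)).const_add
            (simplexPoint (Fin.init z) t a))
        have hpc : Continuous (fun s : ℝ => simplexPoint z (Fin.snoc t s) x) :=
          continuous_iff_continuousAt.2 fun s => (hpath s).continuousAt
        have := intervalIntegral.integral_eq_sub_of_hasDerivAt (a := 0)
          (b := consOne t (Fin.last N))
          (f := fun s : ℝ => iteratedDeriv N h (simplexPoint z (Fin.snoc t s) x))
          (f' := fun s : ℝ =>
            (x - a) * iteratedDeriv (N + 1) h (simplexPoint z (Fin.snoc t s) x))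
          (fun s hs => ?_) ?_
        · simp only [intervalIntegral.integral_const_mul] at this
          simp only [this]
          simp [simplexPoint_snoc, simplexPoint_eq_add_mul_sub (Fin.init z) t x a, a]
        · rw [iteratedDeriv_succ]
          have := (hhj N _ (hmem hs)).differentiableAt.hasDerivAt.comp s (hpath s)
          rwa [mul_comm] at this
        · exact (continuousOn_const.mul ((hhj (N + 1)).continuousOn.comp hpc.continuousOn
            fun s hs => hmem hs)).intervalIntegrable
      have := hqx x hx
      rw [this]
      simp only [Fin.prod_univ_castSucc, eval_add, eval_mul, eval_C, eval_sub, eval_X]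
      change _ = _ + _ * (x - a) * _
      rw [mul_assoc, key]
      simp only [Fin.init, D]
      ring

theorem le_analyticOrderAt_add_of_le {f g : ℂ → ℂ} {x : ℂ} {m : ℕ∞}
    (hf : m ≤ analyticOrderAt f x) (hg : m ≤ analyticOrderAt g x) :
    m ≤ analyticOrderAt (f + g) x :=
  (le_min hf hg).trans le_analyticOrderAt_add

theorem le_analyticOrderAt_mul_of_le_right {f g : ℂ → ℂ} {x : ℂ} {m : ℕ∞}
    (hf : AnalyticAt ℂ f x) (hg : AnalyticAt ℂ g x) (h : m ≤ analyticOrderAt g x) :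
    m ≤ analyticOrderAt (f * g) x := by
  rw [analyticOrderAt_mul hf hg]
  exact h.trans le_add_self

theorem le_analyticOrderAt_of_X_sub_C_pow_dvd {P : ℂ[X]} {a : ℂ} {m : ℕ}
    (h : (X - C a) ^ m ∣ P) : (m : ℕ∞) ≤ analyticOrderAt (fun w => P.eval w) a := by
  obtain ⟨Q, rfl⟩ := h
  rw [natCast_le_analyticOrderAt (analyticAt_polynomial_eval _ a)]
  exact ⟨_, analyticAt_polynomial_eval Q a, .of_forall fun w => by simp⟩

theorem prod_X_sub_C_eq_prod_image_pow {N : ℕ} (z : Fin N → ℂ) :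
    ∏ k, (X - C (z k)) = ∏ a ∈ Finset.univ.image z,
      (X - C a) ^ (Finset.univ.filter fun i => z i = a).card :=
  Finset.prod_comp (fun a => X - C a) z

theorem eq_of_le_analyticOrderAt_sub {N : ℕ} {z : Fin N → ℂ} {u q : ℂ[X]}
    (hu : u.degree < N) (hq : q.degree < N)
    (h : ∀ k, ((Finset.univ.filter fun i => z i = z k).card : ℕ∞) ≤
      analyticOrderAt (fun w => (u - q).eval w) (z k)) : u = q := by
  have hdvd : ∏ k, (X - C (z k)) ∣ u - q := by
    rw [prod_X_sub_C_eq_prod_image_pow]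
    refine prod_X_sub_C_pow_dvd_of_le_analyticOrderAt _
      (fun a => (Finset.univ.filter fun i => z i = a).card) fun a ha => ?_
    obtain ⟨k, -, rfl⟩ := Finset.mem_image.1 ha
    exact h k
  refine sub_eq_zero.1 (eq_zero_of_dvd_of_degree_lt hdvd ?_)
  refine (degree_sub_le _ _).trans_lt ((max_lt hu hq).trans_le (le_of_eq ?_))
  simp [degree_prod]

theorem analyticOnNhd_setIntegral_simplexPoint {N : ℕ} {z : Fin N → ℂ} {U : Set ℂ}
    (hUo : IsOpen U) (hU : Convex ℝ U) (hz : ∀ k, z k ∈ U) {g : ℂ → ℂ}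
    (hg : AnalyticOnNhd ℂ g U) :
    AnalyticOnNhd ℂ (fun x => ∫ t in orderedSimplex N, g (simplexPoint z t x)) U := by
  refine DifferentiableOn.analyticOnNhd (fun x hx => ?_) hUo
  have := hasDerivAt_setIntegral_simplexPoint hUo hU hz hg 0 hx
  simp only [pow_zero, one_mul] at this
  exact this.differentiableAt.differentiableWithinAt

/-- If `u / v` interpolates `f` at the points `z`, then `v f - u` is the nodal polynomial times
the integral over the simplex of the `N`-th derivative of `v f`. -/
theorem mul_sub_eval_eq_prod_mul_setIntegral {N : ℕ} {z : Fin N → ℂ} {U : Set ℂ}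
    (hUo : IsOpen U) (hU : Convex ℝ U) (hz : ∀ k, z k ∈ U) {f : ℂ → ℂ}
    (hf : AnalyticOnNhd ℂ f U) {u v : ℂ[X]} (hv : ∀ k, v.eval (z k) ≠ 0) (hu : u.degree < N)
    (hinterp : ∀ k : Fin N, ∀ j < (Finset.univ.filter fun i => z i = z k).card,
      iteratedDeriv j (fun w => u.eval w / v.eval w) (z k) = iteratedDeriv j f (z k))
    {x : ℂ} (hx : x ∈ U) :
    v.eval x * f x - u.eval x = (∏ k, (X - C (z k))).eval x *
      ∫ t in orderedSimplex N,
        iteratedDeriv N (fun w => v.eval w * f w) (simplexPoint z t x) := by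
  have hh : AnalyticOnNhd ℂ (fun w => v.eval w * f w) U := fun w hw =>
    (analyticAt_polynomial_eval v w).mul (hf w hw)
  obtain ⟨q, hq, hqx⟩ := exists_newton_remainder hU hz hh
  have hK := analyticOnNhd_setIntegral_simplexPoint hUo hU hz (analyticOnNhd_iteratedDeriv hh N)
  set K : ℂ → ℂ := fun x => ∫ t in orderedSimplex N,
    iteratedDeriv N (fun w => v.eval w * f w) (simplexPoint z t x) with hKdef
  have huq : u = q := by
    refine eq_of_le_analyticOrderAt_sub (z := z) hu hq fun k => ?_
    have hdiv : AnalyticAt ℂ (fun w => u.eval w / v.eval w) (z k) :=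
      (analyticAt_polynomial_eval u _).div (analyticAt_polynomial_eval v _) (hv k)
    have h1 := le_analyticOrderAt_mul_of_le_right (analyticAt_polynomial_eval v (z k))
      (hdiv.sub (hf _ (hz k)))
      ((natCast_le_analyticOrderAt_sub_iff hdiv (hf _ (hz k))).2 (hinterp k))
    have h2 : ((Finset.univ.filter fun i => z i = z k).card : ℕ∞) ≤
        analyticOrderAt (fun w => (∏ k, (X - C (z k))).eval w) (z k) := by
      refine le_analyticOrderAt_of_X_sub_C_pow_dvd ?_
      rw [prod_X_sub_C_eq_prod_image_pow]
      exact Finset.dvd_prod_of_mem (fun a => (X - C a) ^ (Finset.univ.filter fun i => z i = a).card)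
        (Finset.mem_image_of_mem z (Finset.mem_univ k))
    have h3 := le_analyticOrderAt_add_of_le h1
      (le_analyticOrderAt_mul_of_le_right (hK _ (hz k)) (analyticAt_polynomial_eval _ _) h2)
    refine h3.trans (le_of_eq (analyticOrderAt_congr ?_))
    have hv' := (analyticAt_polynomial_eval v (z k)).continuousAt.eventually_ne (hv k)
    filter_upwards [hUo.mem_nhds (hz k), hv'] with w hw hvw
    have := hqx w hw
    simp only [Pi.add_apply, Pi.mul_apply, Pi.sub_apply, eval_sub]
    rw [mul_sub, mul_div_cancel₀ _ hvw, this]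
    ring
  rw [hqx x hx, huq]
  ring

theorem MatFunEq.eq_aeval {n : ℕ} {A B : Matrix (Fin n) (Fin n) ℂ} {h : ℂ → ℂ}
    (hB : MatFunEq A h B) {p : ℂ[X]}
    (hp : ∀ a ∈ spectrum ℂ A, ∀ j < n,
      iteratedDeriv j h a = iteratedDeriv j (fun w => p.eval w) a) : B = aeval A p :=
  hB p fun a ha j hj => hp a ha j (hj.trans_le (rootMultiplicity_charpoly_le A a))

theorem aeval_eq_aeval_of_iteratedDeriv_eq {n : ℕ} (A : Matrix (Fin n) (Fin n) ℂ) {p q : ℂ[X]}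
    (h : ∀ a ∈ spectrum ℂ A, ∀ j < n, iteratedDeriv j (fun w => p.eval w) a =
      iteratedDeriv j (fun w => q.eval w) a) : aeval A p = aeval A q := by
  rw [← sub_eq_zero, ← map_sub]
  refine aeval_eq_zero_of_le_analyticOrderAt A fun a ha => ?_
  simpa [Pi.sub_def] using (natCast_le_analyticOrderAt_sub_iff (analyticAt_polynomial_eval p a)
    (analyticAt_polynomial_eval q a)).2 (h a ha)

theorem MatFunEq.eq_aeval_of_comp_simplexPoint {n N : ℕ} {A B : Matrix (Fin n) (Fin n) ℂ}
    {z : Fin N → ℂ} {U : Set ℂ} (hUo : IsOpen U) (hU : Convex ℝ U) (hUA : spectrum ℂ A ⊆ U)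
    (hz : ∀ k, z k ∈ U) {g : ℂ → ℂ} (hg : AnalyticOnNhd ℂ g U) {t : Fin N → ℝ}
    (ht : t ∈ orderedSimplex N)
    (hB : MatFunEq
      ((∑ k : Fin N, (((consOne t k.castSucc - consOne t k.succ : ℝ) : ℂ) * z k)) •
          (1 : Matrix (Fin n) (Fin n) ℂ)
        + ((consOne t (Fin.last N) : ℝ) : ℂ) • A) g B)
    {Q : ℂ[X]} (hQ : ∀ a ∈ spectrum ℂ A, ∀ j < n,
      iteratedDeriv j (fun x => g (simplexPoint z t x)) a =
        iteratedDeriv j (fun w => Q.eval w) a) :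
    B = aeval A Q := by
  rcases n.eq_zero_or_pos with rfl | hn
  · exact Subsingleton.elim _ _
  have : Nonempty (Fin n) := ⟨⟨0, hn⟩⟩
  set c := ∑ k : Fin N, (((consOne t k.castSucc - consOne t k.succ : ℝ) : ℂ) * z k) with hc
  set τ : ℂ := ((consOne t (Fin.last N) : ℝ) : ℂ) with hτ
  have hL (x : ℂ) : (C c + C τ * X).eval x = simplexPoint z t x := by
    simp only [eval_add, eval_mul, eval_C, eval_X, simplexPoint, hc, hτ]
  have hM : c • (1 : Matrix (Fin n) (Fin n) ℂ) + τ • A = aeval A (C c + C τ * X) := by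
    simp [Algebra.algebraMap_eq_smul_one]
  have hspec : spectrum ℂ (aeval A (C c + C τ * X)) = simplexPoint z t '' spectrum ℂ A := by
    rw [spectrum.map_polynomial_aeval_of_nonempty A _
      (spectrum.nonempty_of_isAlgClosed_of_finiteDimensional ℂ A)]
    simp only [hL]
  have hfin : (spectrum ℂ (aeval A (C c + C τ * X))).Finite := Matrix.finite_spectrum _
  obtain ⟨T, hT⟩ := exists_linear_hermite_interpolation hfin.toFinset n
  set p := T fun s j => iteratedDeriv j g s
  have hp : ∀ a ∈ spectrum ℂ A, ∀ j < n, iteratedDeriv j g (simplexPoint z t a) =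
      iteratedDeriv j (fun w => p.eval w) (simplexPoint z t a) := fun a ha j hj =>
    (hT (fun s j => iteratedDeriv j g s)
      ⟨simplexPoint z t a, by rw [Set.Finite.mem_toFinset, hspec]; exact ⟨a, ha, rfl⟩⟩ ⟨j, hj⟩).symm
  rw [hM] at hB
  rw [hB.eq_aeval (p := p), ← aeval_comp]
  · refine aeval_eq_aeval_of_iteratedDeriv_eq A fun a ha j hj => ?_
    simp only [eval_comp, hL]
    rw [← hQ a ha j hj, iteratedDeriv_comp_simplexPoint hUo hU hz hg j (hUA ha) ht,
      iteratedDeriv_comp_simplexPoint hUo hU hz (g := fun w => p.eval w)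
        (fun w _ => analyticAt_polynomial_eval p w) j (hUA ha) ht, hp a ha j hj]
  · rw [hspec]
    rintro _ ⟨a, ha, rfl⟩ j hj
    exact hp a ha j hj

theorem of_setIntegral_eq_aeval {n N : ℕ} {A : Matrix (Fin n) (Fin n) ℂ}
    {z : Fin N → ℂ} {U : Set ℂ} (hUo : IsOpen U) (hU : Convex ℝ U) (hUA : spectrum ℂ A ⊆ U)
    (hz : ∀ k, z k ∈ U) {g : ℂ → ℂ} (hg : AnalyticOnNhd ℂ g U)
    {G : (Fin N → ℝ) → Matrix (Fin n) (Fin n) ℂ}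
    (hG : ∀ t ∈ orderedSimplex N, MatFunEq
      ((∑ k : Fin N, (((consOne t k.castSucc - consOne t k.succ : ℝ) : ℂ) * z k)) •
          (1 : Matrix (Fin n) (Fin n) ℂ)
        + ((consOne t (Fin.last N) : ℝ) : ℂ) • A) g (G t))
    {S : Finset ℂ} (hS : ∀ a, a ∈ S ↔ a ∈ spectrum ℂ A) {T : (S → Fin n → ℂ) →ₗ[ℂ] ℂ[X]}
    (hT : ∀ a (s : S) (j : Fin n), iteratedDeriv j (fun w => (T a).eval w) s = a s j) :
    Matrix.of (fun i j => ∫ t in orderedSimplex N, G t i j) =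
      aeval A (T fun s j => iteratedDeriv j
        (fun x => ∫ t in orderedSimplex N, g (simplexPoint z t x)) s) := by
  set J : (Fin N → ℝ) → S → Fin n → ℂ := fun t s j =>
    (consOne t (Fin.last N) : ℂ) ^ (j : ℕ) * iteratedDeriv j g (simplexPoint z t s) with hJ
  have hsU (s : S) : (s : ℂ) ∈ U := hUA ((hS s).1 s.2)
  have hGJ : ∀ t ∈ orderedSimplex N, G t = aeval A (T (J t)) := fun t ht =>
    (hG t ht).eq_aeval_of_comp_simplexPoint hUo hU hUA hz hg ht fun a ha j hj => by
      rw [hT _ ⟨a, (hS a).2 ha⟩ ⟨j, hj⟩,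
        iteratedDeriv_comp_simplexPoint hUo hU hz hg j (hUA ha) ht]
  have hcompact := isCompact_orderedSimplex N
  have hJint : IntegrableOn J (orderedSimplex N) := by
    refine ContinuousOn.integrableOn_compact hcompact ?_
    refine continuousOn_pi.2 fun s => continuousOn_pi.2 fun j => ?_
    refine ((Complex.continuous_ofReal.comp (continuous_consOne _)).pow _).continuousOn.mul ?_
    exact (analyticOnNhd_iteratedDeriv hg j).continuousOn.comp
      ((continuous_simplexPoint z).comp
        (by fun_prop : Continuous fun t : Fin N → ℝ => (t, (s : ℂ)))).continuousOn
      fun t ht => simplexPoint_mem hU hz ht (hsU s)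
  have hJK : ∫ t in orderedSimplex N, J t = fun (s : S) (j : Fin n) => iteratedDeriv j
      (fun x => ∫ t in orderedSimplex N, g (simplexPoint z t x)) s := by
    ext s j
    rw [iteratedDeriv_setIntegral_simplexPoint hUo hU hz hg j (hsU s)]
    exact (((ContinuousLinearMap.proj j : (Fin n → ℂ) →L[ℂ] ℂ).comp
      (ContinuousLinearMap.proj s : (S → Fin n → ℂ) →L[ℂ] (Fin n → ℂ))).integral_comp_comm
        hJint).symm
  ext i j
  rw [← hJK, Matrix.of_apply]
  let L : (S → Fin n → ℂ) →ₗ[ℂ] ℂ :=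
    Matrix.entryLinearMap ℂ ℂ i j ∘ₗ (aeval A).toLinearMap ∘ₗ T
  calc ∫ t in orderedSimplex N, G t i j = ∫ t in orderedSimplex N, L.toContinuousLinearMap (J t) :=
        setIntegral_congr_fun hcompact.measurableSet fun t ht => by
          simp only [hGJ t ht]
          rfl
    _ = L.toContinuousLinearMap (∫ t in orderedSimplex N, J t) :=
        L.toContinuousLinearMap.integral_comp_comm hJint
    _ = _ := rfl

theorem isUnit_aeval_of_eval_ne_zero {n : ℕ} {A : Matrix (Fin n) (Fin n) ℂ} {v : ℂ[X]}
    (hv : ∀ a ∈ spectrum ℂ A, v.eval a ≠ 0) : IsUnit (aeval A v) := by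
  rcases n.eq_zero_or_pos with rfl | hn
  · exact isUnit_of_subsingleton _
  have : Nonempty (Fin n) := ⟨⟨0, hn⟩⟩
  refine spectrum.isUnit_of_zero_notMem ℂ ?_
  rw [spectrum.map_polynomial_aeval_of_nonempty A _
      (spectrum.nonempty_of_isAlgClosed_of_finiteDimensional ℂ A)]
  rintro ⟨a, ha, h⟩
  exact hv a ha h

/- STATEMENT 3: integral representation of f(A) − u(A) v(A)⁻¹ over the simplex. The
matrix appearing in the integrand is
`((1−t₁)z₁ + (t₁−t₂)z₂ + ⋯ + (t_{N−1}−t_N)z_N) • 1 + t_N • A`; with `s = consOne t`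
its scalar part is `∑ k, (s k.castSucc − s k.succ) * z k` and `t_N = s (Fin.last N)`. -/
theorem rational_interpolation_matrix_remainder_integral
    {n N : ℕ} (A : Matrix (Fin n) (Fin n) ℂ) (z : Fin N → ℂ)
    (U : Set ℂ) (hU : IsOpen U) (hUconv : Convex ℝ U)
    (hUA : spectrum ℂ A ⊆ U) (hUz : ∀ k, z k ∈ U)
    (f : ℂ → ℂ) (hf : AnalyticOnNhd ℂ f U)
    (v : Polynomial ℂ) (hvz : ∀ k, v.eval (z k) ≠ 0)
    (hvA : ∀ lam ∈ spectrum ℂ A, v.eval lam ≠ 0)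
    (u : Polynomial ℂ) (hu : u.degree < (N : WithBot ℕ))
    (hinterp : ∀ k : Fin N,
      ∀ j < (Finset.univ.filter fun i => z i = z k).card,
        iteratedDeriv j (fun w => u.eval w / v.eval w) (z k)
          = iteratedDeriv j f (z k))
    (fA : Matrix (Fin n) (Fin n) ℂ) (hfA : MatFunEq A f fA)
    (G : (Fin N → ℝ) → Matrix (Fin n) (Fin n) ℂ)
    (hG : ∀ t ∈ orderedSimplex N,
      MatFunEq
        ((∑ k : Fin N,
            (((consOne t k.castSucc - consOne t k.succ : ℝ) : ℂ) * z k)) •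
              (1 : Matrix (Fin n) (Fin n) ℂ)
          + ((consOne t (Fin.last N) : ℝ) : ℂ) • A)
        (iteratedDeriv N fun w => v.eval w * f w)
        (G t)) :
    fA - Polynomial.aeval A u * (Polynomial.aeval A v)⁻¹ =
      Polynomial.aeval A (∏ k, (X - C (z k))) * (Polynomial.aeval A v)⁻¹ *
        Matrix.of (fun i j => ∫ t in orderedSimplex N, G t i j) := by
  have hh : AnalyticOnNhd ℂ (fun w => v.eval w * f w) U := fun w hw =>
    (analyticAt_polynomial_eval v w).mul (hf w hw)
  have hg := analyticOnNhd_iteratedDeriv hh N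
  have hK := analyticOnNhd_setIntegral_simplexPoint hU hUconv hUz hg
  have hfin : (spectrum ℂ A).Finite := Matrix.finite_spectrum A
  obtain ⟨T, hT⟩ := exists_linear_hermite_interpolation hfin.toFinset n
  have hTjet {φ : ℂ → ℂ} {a : ℂ} (ha : a ∈ spectrum ℂ A) {j : ℕ} (hj : j < n) :
      iteratedDeriv j φ a =
        iteratedDeriv j (fun w => (T fun s j => iteratedDeriv j φ s).eval w) a :=
    (hT (fun s j => iteratedDeriv j φ s) ⟨a, hfin.mem_toFinset.2 ha⟩ ⟨j, hj⟩).symm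
  rw [of_setIntegral_eq_aeval hU hUconv hUA hUz hg hG (fun _ => hfin.mem_toFinset) hT,
    hfA.eq_aeval fun a ha j hj => hTjet ha hj]
  set K : ℂ → ℂ := fun x => ∫ t in orderedSimplex N,
    iteratedDeriv N (fun w => v.eval w * f w) (simplexPoint z t x) with hKdef
  set F := T fun s j => iteratedDeriv j f s
  set P := T fun s j => iteratedDeriv j K s
  set W : ℂ[X] := ∏ k, (X - C (z k)) with hW
  have hzero : aeval A (v * F - u - W * P) = 0 := by
    refine aeval_eq_zero_of_le_analyticOrderAt A fun a ha => ?_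
    have hFa := analyticAt_polynomial_eval F a
    have hPa := analyticAt_polynomial_eval P a
    have hfa := hf a (hUA ha)
    have hKa := hK a (hUA ha)
    have h := le_analyticOrderAt_add_of_le
      (le_analyticOrderAt_mul_of_le_right (analyticAt_polynomial_eval v a) (hFa.sub hfa)
        ((natCast_le_analyticOrderAt_sub_iff hFa hfa).2 fun j hj => (hTjet ha hj).symm))
      (le_analyticOrderAt_mul_of_le_right (analyticAt_polynomial_eval W a) (hKa.sub hPa)
        ((natCast_le_analyticOrderAt_sub_iff hKa hPa).2 fun j hj => hTjet ha hj))
    refine h.trans (le_of_eq (analyticOrderAt_congr ?_))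
    filter_upwards [hU.mem_nhds (hUA ha)] with w hw
    have := mul_sub_eval_eq_prod_mul_setIntegral hU hUconv hUz hf hvz hu hinterp hw
    simp only [Pi.add_apply, Pi.mul_apply, Pi.sub_apply, eval_sub, eval_mul]
    linear_combination -this
  rw [map_sub, map_sub, map_mul, map_mul, sub_eq_zero] at hzero
  have hV := isUnit_aeval_of_eval_ne_zero hvA
  have hcomm (p : ℂ[X]) : aeval A v * aeval A p = aeval A p * aeval A v := by
    rw [← map_mul, ← map_mul, mul_comm]
  have hinv : aeval A v * (aeval A v)⁻¹ = 1 :=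
    Matrix.mul_nonsing_inv _ ((Matrix.isUnit_iff_isUnit_det _).1 hV)
  refine hV.mul_left_cancel ?_
  rw [mul_sub, ← mul_assoc (aeval A v) (aeval A u), hcomm u, mul_assoc (aeval A u), hinv, mul_one,
    hzero, ← mul_assoc, ← mul_assoc, hcomm W, mul_assoc (aeval A W), hinv, mul_one]
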